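/- Let (Ω, 𝔉, P) be a probability space, 𝒵 a measurable space, (Z_h)_{h∈ℕ} and (Y_h)_{h∈ℕ} sequences of 𝒵-valued random variables, and τ an ℕ-valued random variable such that, P-almost surely, Z_h(ω) = Y_h(ω) for every h ≥ τ(ω). Let m ≥ 1 be an integer with P(τ > h) ≤ (1/4)^{⌊h/m⌋} for every h ∈ ℕ, and let f_h : 𝒵 → ℝ^d (h ∈ ℕ) be measurable functions with ‖f_h(z)‖ ≤ B for all h and z. Then for every H ∈ ℕ, E[‖Σ_{h=0}^{H−1} f_h(Z_h)‖²] ≤ 2 E[‖Σ_{h=0}^{H−1} f_h(Y_h)‖²] + (160/9) B² m². -/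

import Mathlib

open MeasureTheory

lemma aux_min (t H : ℕ) :
    (∑ h ∈ Finset.range H, (if h < t then (1:ℝ) else 0)) = ((min t H : ℕ) : ℝ) ∧
    (∑ h ∈ Finset.range H, (2 * (h:ℝ) + 1) * (if h < t then (1:ℝ) else 0))
      = ((min t H : ℕ) : ℝ) ^ 2 := by
  induction H with
  | zero => simp
  | succ n ih =>
    rw [Finset.sum_range_succ, Finset.sum_range_succ, ih.1, ih.2]
    by_cases h : n < t
    · rw [min_eq_right (by omega : n ≤ t), min_eq_right (by omega : n + 1 ≤ t)]
      simp only [h, if_true]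
      push_cast
      constructor <;> ring
    · rw [min_eq_left (by omega : t ≤ n), min_eq_left (by omega : t ≤ n + 1)]
      simp [h]

lemma aux_geo (n : ℕ) : (∑ k ∈ Finset.range n, (2 * (k:ℝ) + 1) * (1 / 4 : ℝ) ^ k)
    = 20 / 9 - (1 / 4 : ℝ) ^ n * (24 / 9 * n + 20 / 9) := by
  induction n with
  | zero => norm_num
  | succ n ih =>
    rw [Finset.sum_range_succ, ih, pow_succ]
    push_cast
    ring

lemma aux_odd (k : ℕ) (m : ℕ) :
    (∑ x ∈ Finset.range m, (2 * ((m * k + x : ℕ):ℝ) + 1)) = (m:ℝ) ^ 2 * (2 * k + 1) := by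
  have : ∀ j : ℕ, (∑ x ∈ Finset.range j, (2 * ((m * k + x : ℕ):ℝ) + 1))
      = 2 * m * k * j + (j:ℝ) ^ 2 := by
    intro j
    induction j with
    | zero => simp
    | succ j ih =>
      rw [Finset.sum_range_succ, ih]
      push_cast
      ring
  rw [this]
  ring

lemma aux_block (m : ℕ) (hm : 1 ≤ m) (n : ℕ) :
    (∑ h ∈ Finset.range (m * n), (2 * (h:ℝ) + 1) * (1 / 4 : ℝ) ^ (h / m))
      = (m:ℝ) ^ 2 * ∑ k ∈ Finset.range n, (2 * (k:ℝ) + 1) * (1 / 4 : ℝ) ^ k := by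
  induction n with
  | zero => simp
  | succ n ih =>
    rw [Nat.mul_succ, Finset.sum_range_add, ih, Finset.sum_range_succ, mul_add, ← mul_assoc _ _ ((1 / 4 : ℝ) ^ n),
      ← aux_odd, Finset.sum_mul]
    congr 1
    apply Finset.sum_congr rfl
    intro x hx
    have hx' := Finset.mem_range.1 hx
    have : (m * n + x) / m = n := by
      rw [Nat.mul_add_div (by omega), Nat.div_eq_of_lt hx', add_zero]
    rw [this]

lemma aux_total (m : ℕ) (hm : 1 ≤ m) (H : ℕ) :
    (∑ h ∈ Finset.range H, (2 * (h:ℝ) + 1) * (1 / 4 : ℝ) ^ (h / m)) ≤ 20 / 9 * (m:ℝ) ^ 2 := by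
  calc _ ≤ ∑ h ∈ Finset.range (m * H), (2 * (h:ℝ) + 1) * (1 / 4 : ℝ) ^ (h / m) := by
        apply Finset.sum_le_sum_of_subset_of_nonneg
        · apply Finset.range_mono
          nlinarith
        · intros; positivity
    _ = _ := aux_block m hm H
    _ ≤ (m:ℝ) ^ 2 * (20 / 9) := by
        gcongr
        rw [aux_geo]
        have : 0 ≤ (1 / 4 : ℝ) ^ H * (24 / 9 * H + 20 / 9) := by positivity
        linarith
    _ = _ := by ring

/-- Second inequality relating sums along a chain and along its stationary coupled copy. -/
theorem stmt8 {Ω 𝒵 : Type*} [MeasurableSpace Ω] [MeasurableSpace 𝒵]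
    (μ : Measure Ω) [IsProbabilityMeasure μ] (d : ℕ)
    (Z Y : ℕ → Ω → 𝒵) (τ : Ω → ℕ)
    (hZ : ∀ h, Measurable (Z h)) (hY : ∀ h, Measurable (Y h)) (hτ : Measurable τ)
    (hcouple : ∀ᵐ ω ∂μ, ∀ h, τ ω ≤ h → Z h ω = Y h ω)
    (m : ℕ) (hm : 1 ≤ m)
    (htail : ∀ h : ℕ, μ {ω | h < τ ω} ≤ ENNReal.ofReal ((1 / 4 : ℝ) ^ (h / m)))
    (B : ℝ) (f : ℕ → 𝒵 → EuclideanSpace ℝ (Fin d))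
    (hf : ∀ h, Measurable (f h)) (hfB : ∀ h z, ‖f h z‖ ≤ B)
    (H : ℕ) :
    ∫ ω, ‖∑ h ∈ Finset.range H, f h (Z h ω)‖ ^ 2 ∂μ
      ≤ 2 * ∫ ω, ‖∑ h ∈ Finset.range H, f h (Y h ω)‖ ^ 2 ∂μ
        + (160 / 9) * B ^ 2 * m ^ 2 := by
  have hint : ∀ W : ℕ → Ω → 𝒵, (∀ h, Measurable (W h)) →
      Integrable (fun ω => ‖∑ h ∈ Finset.range H, f h (W h ω)‖ ^ 2) μ := by
    intro W hW
    have hme : Measurable (fun ω => ‖∑ h ∈ Finset.range H, f h (W h ω)‖ ^ 2) := by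
      have : Measurable (fun ω => ∑ h ∈ Finset.range H, f h (W h ω)) :=
        Finset.measurable_fun_sum _ (fun h _ => (hf h).comp (hW h))
      exact this.norm.pow_const 2
    refine Integrable.of_bound hme.aestronglyMeasurable ((H * B) ^ 2) (ae_of_all _ fun ω => ?_)
    rw [Real.norm_of_nonneg (by positivity)]
    have : ‖∑ h ∈ Finset.range H, f h (W h ω)‖ ≤ H * B := by
      refine (norm_sum_le_of_le _ (fun h _ => hfB h (W h ω))).trans ?_
      simp
    gcongr
  have hms : ∀ h : ℕ, MeasurableSet {ω | h < τ ω} := fun h => measurableSet_lt measurable_const hτ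
  have hind : ∀ h : ℕ, (fun ω => if h < τ ω then (1:ℝ) else 0)
      = Set.indicator {ω | h < τ ω} (fun _ => (1:ℝ)) := by
    intro h
    ext ω
    simp [Set.indicator_apply]
  have hI : ∀ h : ℕ, Integrable (fun ω => if h < τ ω then (1:ℝ) else 0) μ := by
    intro h
    rw [hind]
    exact (integrable_const _).indicator (hms h)
  have hE : ∀ h : ℕ, ∫ ω, (if h < τ ω then (1:ℝ) else 0) ∂μ ≤ (1 / 4 : ℝ) ^ (h / m) := by
    intro h
    rw [hind, integral_indicator_const _ (hms h), smul_eq_mul, mul_one]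
    exact ENNReal.toReal_le_of_le_ofReal (by positivity) (htail h)
  have hTI : Integrable (fun ω => ∑ h ∈ Finset.range H,
      (2 * (h:ℝ) + 1) * (if h < τ ω then (1:ℝ) else 0)) μ :=
    integrable_finsetSum _ (fun h _ => (hI h).const_mul _)
  have hT : ∫ ω, ∑ h ∈ Finset.range H,
      (2 * (h:ℝ) + 1) * (if h < τ ω then (1:ℝ) else 0) ∂μ ≤ 20 / 9 * (m:ℝ) ^ 2 := by
    rw [integral_finsetSum _ (fun h _ => (hI h).const_mul _)]
    refine le_trans (Finset.sum_le_sum fun h _ => ?_) (aux_total m hm H)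
    rw [integral_const_mul]
    exact mul_le_mul_of_nonneg_left (hE h) (by positivity)
  have hpt : ∀ᵐ ω ∂μ, ‖∑ h ∈ Finset.range H, f h (Z h ω)‖ ^ 2
      ≤ 2 * ‖∑ h ∈ Finset.range H, f h (Y h ω)‖ ^ 2
        + 8 * B ^ 2 * ∑ h ∈ Finset.range H,
          (2 * (h:ℝ) + 1) * (if h < τ ω then (1:ℝ) else 0) := by
    filter_upwards [hcouple] with ω hω
    rw [(aux_min (τ ω) H).2, ← (aux_min (τ ω) H).1]
    set S := ∑ h ∈ Finset.range H, (if h < τ ω then (1:ℝ) else 0)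
    set a := ∑ h ∈ Finset.range H, f h (Z h ω) with ha
    set b := ∑ h ∈ Finset.range H, f h (Y h ω) with hb
    have hD : ‖a - b‖ ≤ 2 * B * S := by
      rw [ha, hb, ← Finset.sum_sub_distrib, Finset.mul_sum]
      refine norm_sum_le_of_le _ (fun h _ => ?_)
      by_cases hh : h < τ ω
      · have h1 := norm_sub_le (f h (Z h ω)) (f h (Y h ω))
        have h2 := hfB h (Z h ω)
        have h3 := hfB h (Y h ω)
        simp only [hh, if_true]
        linarith
      · rw [hω h (by omega)]
        simp [hh]
    have hab : ‖a‖ ≤ ‖b‖ + ‖a - b‖ := by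
      have := norm_add_le b (a - b)
      simpa using this
    have h0 : ‖a - b‖ ^ 2 ≤ (2 * B * S) ^ 2 := by gcongr
    have h1 : ‖a‖ ^ 2 ≤ (‖b‖ + ‖a - b‖) ^ 2 := by gcongr
    nlinarith [sq_nonneg (‖b‖ - ‖a - b‖)]
  have hfin := integral_mono_ae (hint Z hZ)
    (((hint Y hY).const_mul 2).add (hTI.const_mul (8 * B ^ 2))) hpt
  simp only [Pi.add_apply] at hfin
  rw [integral_add ((hint Y hY).const_mul 2) (hTI.const_mul (8 * B ^ 2)),
    integral_const_mul, integral_const_mul] at hfin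
  have := mul_le_mul_of_nonneg_left hT (by positivity : 0 ≤ 8 * B ^ 2)
  linarith
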